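/- arXiv:2307.01646 — 4 statements merged into one kernel-verified Lean document; each statement's English description precedes it below -/
import Mathlib

section
/- Let 𝒜 be a finite nonempty set of n×n binary matrices and let p_data be the uniform PMF on 𝒜. Every minimizer q* of TV(q, p_data) over all permutation-invariant PMFs q on n×n binary matrices has support intersecting 𝒜; consequently (by permutation invariance) the support of q* contains the entire isomorphism class I_A of at least one training matrix A ∈ 𝒜. -/
/-- Conjugation action of a permutation on an `n × n` binary matrix:
`(σ • A) i j = A (σ⁻¹ i) (σ⁻¹ j)`. -/
def permConj {n : ℕ} (σ : Equiv.Perm (Fin n)) (A : Fin n → Fin n → Bool) :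
    Fin n → Fin n → Bool :=
  fun i j => A (σ⁻¹ i) (σ⁻¹ j)

/-- Every minimizer `q*` of the total variation distance to the empirical
uniform PMF `p_data` on a nonempty training set `𝒜`, over all permutation-invariant
PMFs, has support intersecting `𝒜`; consequently, by permutation invariance, its
support contains the full isomorphism class of some training matrix `A ∈ 𝒜`. -/
theorem stmt3 (n : ℕ) (hn : 1 ≤ n)
    (𝒜 : Finset (Fin n → Fin n → Bool)) (h𝒜 : 𝒜.Nonempty)
    (pdata : (Fin n → Fin n → Bool) → ℝ)
    (hpdata : ∀ A, pdata A = if A ∈ 𝒜 then ((𝒜.card : ℝ))⁻¹ else 0)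
    (qstar : (Fin n → Fin n → Bool) → ℝ)
    (hq0 : ∀ A, 0 ≤ qstar A) (hq1 : ∑ A, qstar A = 1)
    (hqinv : ∀ (σ : Equiv.Perm (Fin n)) A, qstar (permConj σ A) = qstar A)
    (hmin : ∀ q : (Fin n → Fin n → Bool) → ℝ,
      (∀ A, 0 ≤ q A) → (∑ A, q A = 1) →
      (∀ (σ : Equiv.Perm (Fin n)) A, q (permConj σ A) = q A) →
      ∑ B, |qstar B - pdata B| ≤ ∑ B, |q B - pdata B|) :
    (∃ A ∈ 𝒜, 0 < qstar A) ∧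
    (∃ A ∈ 𝒜, ∀ σ : Equiv.Perm (Fin n), 0 < qstar (permConj σ A)) := by
  have h1 : ∃ A ∈ 𝒜, 0 < qstar A := by
    by_contra! hcon
    have hz : ∀ A ∈ 𝒜, qstar A = 0 := fun A hA => le_antisymm (hcon A hA) (hq0 A)
    have hcard : (0 : ℝ) < 𝒜.card := by exact_mod_cast h𝒜.card_pos
    have hp0 : ∀ A, 0 ≤ pdata A := by
      intro A; rw [hpdata]; split_ifs <;> positivity
    have hp1 : ∑ A, pdata A = 1 := by
      simp only [hpdata, Finset.sum_ite_mem, Finset.univ_inter, Finset.sum_const, nsmul_eq_mul]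
      exact mul_inv_cancel₀ hcard.ne'
    have hN : (0 : ℝ) < Fintype.card (Fin n → Fin n → Bool) := by
      exact_mod_cast Fintype.card_pos
    have hu1 : ∑ _A : Fin n → Fin n → Bool,
        ((Fintype.card (Fin n → Fin n → Bool) : ℝ))⁻¹ = 1 := by
      rw [Finset.sum_const, nsmul_eq_mul, Finset.card_univ]
      exact mul_inv_cancel₀ hN.ne'
    have hm := hmin (fun _ => ((Fintype.card (Fin n → Fin n → Bool) : ℝ))⁻¹)
      (fun _ => (inv_pos.mpr hN).le) hu1 (fun _ _ => rfl)
    generalize ((Fintype.card (Fin n → Fin n → Bool) : ℝ))⁻¹ = u at hm hu1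
    have hq2 : ∑ B, |qstar B - pdata B| = 2 := by
      have : ∀ B, |qstar B - pdata B| = qstar B + pdata B := by
        intro B
        by_cases hB : B ∈ 𝒜
        · rw [hz B hB, zero_sub, abs_neg, abs_of_nonneg (hp0 B), zero_add]
        · have : pdata B = 0 := by rw [hpdata, if_neg hB]
          rw [this, sub_zero, add_zero, abs_of_nonneg (hq0 B)]
      simp only [this, Finset.sum_add_distrib, hq1, hp1]
      norm_num
    have hu0 : 0 < u := by
      by_contra! h
      have := Finset.sum_nonpos (s := Finset.univ)
        (f := fun _ : Fin n → Fin n → Bool => u) (fun _ _ => h)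
      linarith
    have hlt : ∑ B, |u - pdata B| < ∑ B, (u + pdata B) := by
      obtain ⟨A, hA⟩ := h𝒜
      refine Finset.sum_lt_sum (fun B _ => ?_) ⟨A, Finset.mem_univ _, ?_⟩
      · have := hp0 B
        rw [abs_le]; constructor <;> linarith
      · have : 0 < pdata A := by rw [hpdata, if_pos hA]; positivity
        rw [abs_lt]; constructor <;> linarith
    rw [Finset.sum_add_distrib, hu1, hp1] at hlt
    linarith
  obtain ⟨A, hA, hpos⟩ := h1
  exact ⟨⟨A, hA, hpos⟩, A, hA, fun σ => by rw [hqinv]; exact hpos⟩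
end

section
/- Let 𝒜 be a finite nonempty set of n×n binary matrices, let p_data be the uniform PMF on 𝒜, let 𝒜* = ⋃_{A ∈ 𝒜} I_A be the union of the isomorphism classes of the training matrices, and let p*_data be the uniform PMF on 𝒜*. Consider the family 𝒫 of PMFs q that are uniform on their support Q, where Q is a union of isomorphism classes (so q is permutation invariant) and Q ⊇ 𝒜. Then min_{q ∈ 𝒫} TV(q, p_data) = 2(1 − |𝒜|/|𝒜*|), and the unique minimizer is p*_data. -/
open scoped Classical

/-- Total variation distance between uniform distributions on nested sets. -/
theorem tv_uniform_nested {n : ℕ} (S Q : Finset (Fin n → Fin n → Bool)) (hS : S.Nonempty)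
    (h : S ⊆ Q) :
    ∑ B, |(if B ∈ Q then ((Q.card : ℝ))⁻¹ else 0) - (if B ∈ S then ((S.card : ℝ))⁻¹ else 0)| =
      2 * (1 - (S.card : ℝ) / (Q.card : ℝ)) := by
  have ha : (0 : ℝ) < S.card := by exact_mod_cast hS.card_pos
  have hle : (S.card : ℝ) ≤ Q.card := by exact_mod_cast Finset.card_le_card h
  have hq : (0 : ℝ) < Q.card := lt_of_lt_of_le ha hle
  have hinv : ((Q.card : ℝ))⁻¹ ≤ ((S.card : ℝ))⁻¹ := inv_anti₀ ha hle
  have key : ∀ B : Fin n → Fin n → Bool,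
      |(if B ∈ Q then ((Q.card : ℝ))⁻¹ else 0) - (if B ∈ S then ((S.card : ℝ))⁻¹ else 0)| =
      (if B ∈ Q then ((Q.card : ℝ))⁻¹ else 0) +
        (if B ∈ S then ((S.card : ℝ))⁻¹ - 2 * ((Q.card : ℝ))⁻¹ else 0) := by
    intro B
    by_cases hB : B ∈ S
    · have hBQ := h hB
      simp only [hB, hBQ, if_true]
      rw [abs_of_nonpos (by linarith)]
      ring
    · by_cases hBQ : B ∈ Q
      · simp [hB, hBQ]
      · simp [hB, hBQ]
  rw [Finset.sum_congr rfl (fun B _ => key B), Finset.sum_add_distrib]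
  simp only [Finset.sum_ite_mem, Finset.univ_inter, Finset.sum_const, nsmul_eq_mul]
  field_simp
  ring

/-- Over the family of PMFs that are uniform on a support `Q` which is a union of
isomorphism classes (hence permutation invariant) and contains the training set `𝒜`,
the minimum total variation distance to the empirical uniform PMF `p_data` on `𝒜`
equals `2(1 − |𝒜|/|𝒜*|)`, and the unique minimizer is `p*_data`, the uniform PMF on
`𝒜* = ⋃_{A ∈ 𝒜} I_A`. -/
theorem stmt5 (n : ℕ) (hn : 1 ≤ n)
    (𝒜 𝒜star : Finset (Fin n → Fin n → Bool)) (h𝒜 : 𝒜.Nonempty)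
    (h𝒜star : ∀ B, B ∈ 𝒜star ↔ ∃ A ∈ 𝒜, ∃ σ : Equiv.Perm (Fin n), B = permConj σ A)
    (pdata pstar : (Fin n → Fin n → Bool) → ℝ)
    (hpdata : ∀ B, pdata B = if B ∈ 𝒜 then ((𝒜.card : ℝ))⁻¹ else 0)
    (hpstar : ∀ B, pstar B = if B ∈ 𝒜star then ((𝒜star.card : ℝ))⁻¹ else 0) :
    (∀ Q : Finset (Fin n → Fin n → Bool), 𝒜 ⊆ Q →
      (∀ (σ : Equiv.Perm (Fin n)) (B), B ∈ Q → permConj σ B ∈ Q) →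
      2 * (1 - (𝒜.card : ℝ) / (𝒜star.card : ℝ)) ≤
        ∑ B, |(if B ∈ Q then ((Q.card : ℝ))⁻¹ else 0) - pdata B|) ∧
    (∑ B, |pstar B - pdata B| = 2 * (1 - (𝒜.card : ℝ) / (𝒜star.card : ℝ))) ∧
    (∀ Q : Finset (Fin n → Fin n → Bool), 𝒜 ⊆ Q →
      (∀ (σ : Equiv.Perm (Fin n)) (B), B ∈ Q → permConj σ B ∈ Q) →
      (∑ B, |(if B ∈ Q then ((Q.card : ℝ))⁻¹ else 0) - pdata B| =
        2 * (1 - (𝒜.card : ℝ) / (𝒜star.card : ℝ))) → Q = 𝒜star) := by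
  have hone : ∀ A : Fin n → Fin n → Bool, permConj 1 A = A := by
    intro A
    funext i j
    simp [permConj]
  have hsub : 𝒜 ⊆ 𝒜star := fun A hA => (h𝒜star A).2 ⟨A, hA, 1, (hone A).symm⟩
  have hmin : ∀ Q : Finset (Fin n → Fin n → Bool), 𝒜 ⊆ Q →
      (∀ (σ : Equiv.Perm (Fin n)) (B), B ∈ Q → permConj σ B ∈ Q) → 𝒜star ⊆ Q := by
    intro Q hQ hinv B hB
    obtain ⟨A, hA, σ, rfl⟩ := (h𝒜star B).1 hB
    exact hinv σ A (hQ hA)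
  have ha : (0 : ℝ) < 𝒜.card := by exact_mod_cast h𝒜.card_pos
  have hs : (0 : ℝ) < 𝒜star.card := by exact_mod_cast (h𝒜.mono hsub).card_pos
  simp only [hpdata, hpstar]
  refine ⟨?_, tv_uniform_nested 𝒜 𝒜star h𝒜 hsub, ?_⟩
  · intro Q hQ hinv
    rw [tv_uniform_nested 𝒜 Q h𝒜 hQ]
    have hc : (𝒜star.card : ℝ) ≤ Q.card := by
      exact_mod_cast Finset.card_le_card (hmin Q hQ hinv)
    have := div_le_div_of_nonneg_left ha.le hs hc
    linarith
  · intro Q hQ hinv heq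
    rw [tv_uniform_nested 𝒜 Q h𝒜 hQ] at heq
    have hq : (0 : ℝ) < Q.card := by exact_mod_cast (h𝒜.mono hQ).card_pos
    have h1 : (𝒜.card : ℝ) / Q.card = (𝒜.card : ℝ) / 𝒜star.card := by linarith
    rw [div_eq_div_iff hq.ne' hs.ne'] at h1
    have h2 : (𝒜star.card : ℝ) = Q.card := mul_left_cancel₀ ha.ne' h1
    have h3 : 𝒜star.card = Q.card := by exact_mod_cast h2
    exact (Finset.eq_of_subset_of_card_le (hmin Q hQ hinv) h3.ge).symm
end

section
/- There exist n ≥ 1, a finite nonempty set 𝒜 of n×n binary matrices with empirical uniform PMF p_data, and a permutation-invariant PMF q whose support contains 𝒜 (but which is not uniform on its support), such that TV(q, p_data) < TV(p*_data, p_data), where p*_data is the uniform PMF on 𝒜* = ⋃_{A ∈ 𝒜} I_A. Consequently, among permutation-invariant PMFs whose support contains 𝒜 without the uniformity constraint, p*_data is not a minimizer of the total variation distance to p_data. (A witness is given by n = 4 with 𝒜 consisting of three matrices, two from an isomorphism class of size 24 and one from an isomorphism class of size 6, and q assigning probability 1/48 to each matrix of the first class and 1/12 to each matrix of the second class.) 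-/
open scoped Classical

/-- `𝒜* = ⋃_{A ∈ 𝒜} I_A`: the union of the isomorphism classes of the matrices in `𝒜`. -/
noncomputable def orbitUnion {n : ℕ} (𝒜 : Finset (Fin n → Fin n → Bool)) :
    Finset (Fin n → Fin n → Bool) :=
  Finset.univ.filter (fun B => ∃ A ∈ 𝒜, ∃ σ : Equiv.Perm (Fin n), B = permConj σ A)

/-- The uniform PMF on a finite set `S` of `n × n` binary matrices. -/
noncomputable def unifPMF {n : ℕ} (S : Finset (Fin n → Fin n → Bool)) :
    (Fin n → Fin n → Bool) → ℝ :=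
  fun B => if B ∈ S then ((S.card : ℝ))⁻¹ else 0

/-- The matrix with a single one at `(0,1)`. -/
def mX : Fin 2 → Fin 2 → Bool := fun i j => decide (i = 0) && decide (j = 1)
/-- The matrix with a single one at `(1,0)`. -/
def mX' : Fin 2 → Fin 2 → Bool := fun i j => decide (i = 1) && decide (j = 0)
/-- The zero matrix. -/
def mY : Fin 2 → Fin 2 → Bool := fun _ _ => false

lemma mXX : mX ≠ mX' := by
  intro h; simpa [mX, mX'] using congrFun (congrFun h 0) 1
lemma mXY : mX ≠ mY := by
  intro h; simpa [mX, mY] using congrFun (congrFun h 0) 1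
lemma mXY' : mX' ≠ mY := by
  intro h; simpa [mX', mY] using congrFun (congrFun h 1) 0

lemma perm_two (σ : Equiv.Perm (Fin 2)) : σ = 1 ∨ σ = Equiv.swap 0 1 := by
  revert σ; decide

lemma conj_one (B : Fin 2 → Fin 2 → Bool) : permConj 1 B = B := rfl

lemma conj_swap_swap (B : Fin 2 → Fin 2 → Bool) :
    permConj (Equiv.swap 0 1) (permConj (Equiv.swap 0 1) B) = B := by
  funext i j; simp [permConj]

lemma conj_X : permConj (Equiv.swap 0 1) mX = mX' := by
  funext i j; fin_cases i <;> fin_cases j <;> simp [permConj, mX, mX']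

lemma conj_X' : permConj (Equiv.swap 0 1) mX' = mX := by
  rw [← conj_X, conj_swap_swap]

lemma conj_Y (σ : Equiv.Perm (Fin 2)) : permConj σ mY = mY := rfl

lemma swap_eq (B C : Fin 2 → Fin 2 → Bool) :
    permConj (Equiv.swap 0 1) B = C ↔ B = permConj (Equiv.swap 0 1) C := by
  constructor
  · rintro rfl; rw [conj_swap_swap]
  · rintro rfl; rw [conj_swap_swap]

lemma orbit_eq : orbitUnion ({mX, mY} : Finset _) = {mX, mX', mY} := by
  ext B
  simp only [orbitUnion, Finset.mem_filter, Finset.mem_univ, true_and, Finset.mem_insert,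
    Finset.mem_singleton]
  constructor
  · rintro ⟨A, rfl | rfl, σ, rfl⟩
    · rcases perm_two σ with rfl | rfl
      · exact Or.inl rfl
      · exact Or.inr (Or.inl conj_X)
    · exact Or.inr (Or.inr rfl)
  · rintro (rfl | rfl | rfl)
    · exact ⟨mX, Or.inl rfl, 1, rfl⟩
    · exact ⟨mX, Or.inl rfl, _, conj_X.symm⟩
    · exact ⟨mY, Or.inr rfl, 1, rfl⟩

/-- The better invariant distribution. -/
noncomputable def qq (B : Fin 2 → Fin 2 → Bool) : ℝ :=
  if B = mY then 1 / 2 else if B = mX ∨ B = mX' then 1 / 4 else 0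

lemma sum_three (f : (Fin 2 → Fin 2 → Bool) → ℝ)
    (hf : ∀ B, B ≠ mX → B ≠ mX' → B ≠ mY → f B = 0) :
    ∑ B, f B = f mX + (f mX' + f mY) := by
  rw [← Finset.sum_subset (Finset.subset_univ ({mX, mX', mY} : Finset _))]
  · rw [Finset.sum_insert, Finset.sum_insert, Finset.sum_singleton]
    · simp [mXY']
    · simp [mXX, mXY]
  · intro B _ hB
    simp only [Finset.mem_insert, Finset.mem_singleton, not_or] at hB
    exact hf B hB.1 hB.2.1 hB.2.2

lemma qX : qq mX = 1 / 4 := by simp [qq, mXY]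
lemma qX' : qq mX' = 1 / 4 := by simp [qq, mXY']
lemma qY : qq mY = 1 / 2 := by simp [qq]
lemma q0 (B) (h1 : B ≠ mX) (h2 : B ≠ mX') (h3 : B ≠ mY) : qq B = 0 := by
  simp [qq, h1, h2, h3]

lemma card2 : ({mX, mY} : Finset (Fin 2 → Fin 2 → Bool)).card = 2 :=
  Finset.card_pair mXY
lemma card3 : ({mX, mX', mY} : Finset (Fin 2 → Fin 2 → Bool)).card = 3 :=
  Finset.card_eq_three.2 ⟨_, _, _, mXX, mXY, mXY', rfl⟩

/-- There exist `n ≥ 1`, a finite nonempty training set `𝒜` of `n × n` binary matrices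
with empirical uniform PMF `p_data`, and a permutation-invariant PMF `q` whose support
contains `𝒜` but which is not uniform on its support, such that
`TV(q, p_data) < TV(p*_data, p_data)` where `p*_data` is the uniform PMF on
`𝒜* = ⋃_{A ∈ 𝒜} I_A`.  Hence `p*_data` is not a TV-minimizer among permutation-invariant
PMFs whose support contains `𝒜` once the uniformity constraint is dropped. -/
theorem stmt7 :
    ∃ (n : ℕ), 1 ≤ n ∧
    ∃ 𝒜 : Finset (Fin n → Fin n → Bool), 𝒜.Nonempty ∧
    ∃ q : (Fin n → Fin n → Bool) → ℝ,
      (∀ B, 0 ≤ q B) ∧ (∑ B, q B = 1) ∧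
      (∀ (σ : Equiv.Perm (Fin n)) B, q (permConj σ B) = q B) ∧
      (∀ A ∈ 𝒜, 0 < q A) ∧
      (¬ ∃ c : ℝ, ∀ B, 0 < q B → q B = c) ∧
      ∑ B, |q B - unifPMF 𝒜 B| <
        ∑ B, |unifPMF (orbitUnion 𝒜) B - unifPMF 𝒜 B| := by
  refine ⟨2, by norm_num, {mX, mY}, ⟨mX, by simp⟩, qq, ?_, ?_, ?_, ?_, ?_, ?_⟩
  · intro B; unfold qq; split_ifs <;> norm_num
  · rw [sum_three _ q0, qX, qX', qY]; norm_num
  · intro σ B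
    rcases perm_two σ with rfl | rfl
    · rfl
    · simp only [qq, swap_eq, conj_X, conj_X', conj_Y]
      simp only [or_comm]
  · intro A hA
    simp only [Finset.mem_insert, Finset.mem_singleton] at hA
    rcases hA with rfl | rfl
    · rw [qX]; norm_num
    · rw [qY]; norm_num
  · rintro ⟨c, hc⟩
    have h1 := hc mX (by rw [qX]; norm_num)
    have h2 := hc mY (by rw [qY]; norm_num)
    rw [qX] at h1
    rw [qY] at h2
    linarith
  · rw [orbit_eq, sum_three, sum_three, qX, qX', qY]
    · simp only [unifPMF, card2, card3, Finset.mem_insert, Finset.mem_singleton, mXX.symm, mXY',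
        true_or, or_true, or_self, if_true, if_false]
      norm_num [abs_of_pos, abs_of_neg]
    · intro B h1 h2 h3
      simp [unifPMF, h1, h2, h3]
    · intro B h1 h2 h3
      simp [unifPMF, h1, h3, q0 B h1 h2 h3]
end

section
/- Let n ≥ 1, σ > 0, and let γ be the product Gaussian measure on ℝ^(n×n) with i.i.d. N(0, σ²) entries. Let 𝒜 = {A_1, …, A_m} be a finite set of n×n real matrices lying in pairwise distinct isomorphism classes, and suppose all isomorphism classes I_{A_1}, …, I_{A_m} have the same finite cardinality. Let 𝒜* = ⋃_{i=1}^m I_{A_i}. Let s : ℝ^(n×n) → ℝ^(n×n) be a measurable permutation-equivariant function, i.e., s(τ • X) = τ • s(X) for all permutations τ and all X, such that the function E ↦ ‖s(A + E) + E/σ²‖_F² is γ-integrable for each A ∈ 𝒜*. Then (1/m) Σ_{A ∈ 𝒜} ∫ ‖s(A + E) + E/σ²‖_F² dγ(E) = (1/|𝒜*|) Σ_{A ∈ 𝒜*} ∫ ‖s(A + E) + E/σ²‖_F² dγ(E). -/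
open MeasureTheory ProbabilityTheory

/-- Conjugation action of a permutation on a real matrix indexed by `Fin n × Fin n`:
`(τ • X) (i, j) = X (τ⁻¹ i, τ⁻¹ j)`. -/
def permConjR {n : ℕ} (τ : Equiv.Perm (Fin n)) (X : Fin n × Fin n → ℝ) :
    Fin n × Fin n → ℝ :=
  fun p => X (τ⁻¹ p.1, τ⁻¹ p.2)

/-- The product Gaussian measure on `ℝ^(n×n)` with i.i.d. `N(0, σ²)` entries. -/
noncomputable def gaussPi (n : ℕ) (σ : NNReal) : Measure (Fin n × Fin n → ℝ) :=
  Measure.pi fun _ : Fin n × Fin n => gaussianReal 0 (σ ^ 2)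

theorem permConjR_mp {n : ℕ} (σ : NNReal) (τ : Equiv.Perm (Fin n)) :
    MeasurePreserving (permConjR τ) (gaussPi n σ) (gaussPi n σ) := by
  have h := measurePreserving_piCongrLeft
    (fun _ : Fin n × Fin n => gaussianReal 0 (σ ^ 2)) (Equiv.prodCongr τ τ)
  have e : (permConjR τ : (Fin n × Fin n → ℝ) → _) =
      MeasurableEquiv.piCongrLeft (fun _ : Fin n × Fin n => ℝ) (Equiv.prodCongr τ τ) := by
    funext X p
    obtain ⟨q, rfl⟩ := (Equiv.prodCongr τ τ).surjective p
    rw [MeasurableEquiv.coe_piCongrLeft, Equiv.piCongrLeft_apply_apply]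
    simp [permConjR]
  rw [e]
  exact h

theorem permConjR_mul {n : ℕ} (τ ρ : Equiv.Perm (Fin n)) (X : Fin n × Fin n → ℝ) :
    permConjR τ (permConjR ρ X) = permConjR (τ * ρ) X := by
  funext p
  simp [permConjR]

theorem loss_inv {n : ℕ} (σ : NNReal)
    (s : (Fin n × Fin n → ℝ) → (Fin n × Fin n → ℝ)) (hsmeas : Measurable s)
    (hequiv : ∀ (τ : Equiv.Perm (Fin n)) (X), s (permConjR τ X) = permConjR τ (s X))
    (τ : Equiv.Perm (Fin n)) (B : Fin n × Fin n → ℝ) :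
    (∫ E, (∑ p : Fin n × Fin n,
        (s (permConjR τ B + E) p + E p / (σ : ℝ) ^ 2) ^ 2) ∂(gaussPi n σ)) =
    ∫ E, (∑ p : Fin n × Fin n,
        (s (B + E) p + E p / (σ : ℝ) ^ 2) ^ 2) ∂(gaussPi n σ) := by
  have hm : Measurable (fun E : Fin n × Fin n → ℝ => ∑ p : Fin n × Fin n,
        (s (permConjR τ B + E) p + E p / (σ : ℝ) ^ 2) ^ 2) := by
    fun_prop
  have hp := permConjR_mp σ τ
  conv_lhs => rw [← hp.map_eq]
  rw [integral_map hp.measurable.aemeasurable hm.aestronglyMeasurable]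
  congr 1
  funext E
  have h1 : permConjR τ B + permConjR τ E = permConjR τ (B + E) := rfl
  rw [h1, hequiv]
  exact Equiv.sum_comp (Equiv.prodCongr τ⁻¹ τ⁻¹)
    (fun p => (s (B + E) p + E p / (σ : ℝ) ^ 2) ^ 2)

/-- For training matrices `A₁, …, A_m` in pairwise distinct isomorphism classes of equal
finite cardinality, with `𝒜* = ⋃ᵢ I_{Aᵢ}`, and a measurable permutation-equivariant score
function `s` with integrable squared DSM error, the DSM objective under the empirical
distribution (uniform on `{Aᵢ}`) equals the DSM objective under the invariant distribution
(uniform on `𝒜*`):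
`(1/m) ∑ᵢ ∫ ‖s(Aᵢ+E) + E/σ²‖_F² dγ(E) = (1/|𝒜*|) ∑_{A ∈ 𝒜*} ∫ ‖s(A+E) + E/σ²‖_F² dγ(E)`. -/
theorem stmt10 (n m : ℕ) (hn : 1 ≤ n) (hm : 1 ≤ m) (σ : NNReal) (hσ : 0 < σ)
    (A : Fin m → (Fin n × Fin n → ℝ))
    (hdistinct : ∀ i j : Fin m, i ≠ j → ∀ τ : Equiv.Perm (Fin n), permConjR τ (A i) ≠ A j)
    (hsamecard : ∀ i j : Fin m,
      {B | ∃ τ : Equiv.Perm (Fin n), B = permConjR τ (A i)}.ncard =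
      {B | ∃ τ : Equiv.Perm (Fin n), B = permConjR τ (A j)}.ncard)
    (𝒜star : Finset (Fin n × Fin n → ℝ))
    (h𝒜star : ∀ B, B ∈ 𝒜star ↔ ∃ i, ∃ τ : Equiv.Perm (Fin n), B = permConjR τ (A i))
    (s : (Fin n × Fin n → ℝ) → (Fin n × Fin n → ℝ))
    (hsmeas : Measurable s)
    (hequiv : ∀ (τ : Equiv.Perm (Fin n)) (X), s (permConjR τ X) = permConjR τ (s X))
    (hint : ∀ B ∈ 𝒜star, Integrable
      (fun E => ∑ p : Fin n × Fin n, (s (B + E) p + E p / (σ : ℝ) ^ 2) ^ 2)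
      (gaussPi n σ)) :
    (m : ℝ)⁻¹ * ∑ i, (∫ E, (∑ p : Fin n × Fin n,
        (s (A i + E) p + E p / (σ : ℝ) ^ 2) ^ 2) ∂(gaussPi n σ)) =
    ((𝒜star.card : ℝ))⁻¹ * ∑ B ∈ 𝒜star, (∫ E, (∑ p : Fin n × Fin n,
        (s (B + E) p + E p / (σ : ℝ) ^ 2) ^ 2) ∂(gaussPi n σ)) := by
  classical
  let O : Fin m → Finset (Fin n × Fin n → ℝ) := fun i =>
    Finset.univ.image fun τ : Equiv.Perm (Fin n) => permConjR τ (A i)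
  have hO : ∀ i, {B | ∃ τ : Equiv.Perm (Fin n), B = permConjR τ (A i)} =
      (O i : Set (Fin n × Fin n → ℝ)) := by
    intro i
    ext B
    simp [O, eq_comm]
  have hcard : ∀ i j, (O i).card = (O j).card := by
    intro i j
    have := hsamecard i j
    rwa [hO, hO, Set.ncard_coe_finset, Set.ncard_coe_finset] at this
  have hU : 𝒜star = Finset.univ.biUnion O := by
    ext B
    rw [h𝒜star]
    simp [O, eq_comm]
  have hdisj : ((Finset.univ : Finset (Fin m)) : Set (Fin m)).PairwiseDisjoint O := by
    intro i _ j _ hij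
    refine Finset.disjoint_left.2 ?_
    intro B hi hj
    simp only [O, Finset.mem_image, Finset.mem_univ, true_and] at hi hj
    obtain ⟨τ, rfl⟩ := hi
    obtain ⟨ρ, h⟩ := hj
    apply hdistinct i j hij (ρ⁻¹ * τ)
    rw [← permConjR_mul, ← h, permConjR_mul, inv_mul_cancel]
    rfl
  let i0 : Fin m := ⟨0, hm⟩
  have hpos : 0 < (O i0).card :=
    Finset.card_pos.2 (Finset.univ_nonempty.image _)
  rw [hU, Finset.card_biUnion hdisj, Finset.sum_biUnion hdisj,
    Finset.sum_congr rfl (fun i _ => hcard i i0)]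
  have hs : ∀ i, ∑ B ∈ O i, (∫ E, (∑ p : Fin n × Fin n,
        (s (B + E) p + E p / (σ : ℝ) ^ 2) ^ 2) ∂(gaussPi n σ)) =
      ((O i0).card : ℝ) * ∫ E, (∑ p : Fin n × Fin n,
        (s (A i + E) p + E p / (σ : ℝ) ^ 2) ^ 2) ∂(gaussPi n σ) := by
    intro i
    rw [← hcard i i0, ← nsmul_eq_mul]
    apply Finset.sum_eq_card_nsmul
    intro B hB
    simp only [O, Finset.mem_image, Finset.mem_univ, true_and] at hB
    obtain ⟨τ, rfl⟩ := hB
    exact loss_inv σ s hsmeas hequiv τ (A i)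
  rw [Finset.sum_congr rfl (fun i _ => hs i), ← Finset.mul_sum]
  have hc : ((O i0).card : ℝ) ≠ 0 := by exact_mod_cast hpos.ne'
  have hm' : (m : ℝ) ≠ 0 := by exact_mod_cast (by omega : m ≠ 0)
  simp only [Finset.sum_const, Finset.card_univ, Fintype.card_fin, smul_eq_mul, Nat.cast_mul]
  rw [← mul_assoc, mul_inv, mul_assoc (m : ℝ)⁻¹, inv_mul_cancel₀ hc, mul_one]
end
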